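/- For every ε_1 ∈ ℝ, the matrix of the Killing form of g_{−1}(ε_1) with respect to the ordered basis X_1,…,X_8 has determinant −2^{10}·3^7·ε_1^4; in particular, the Killing form of g_{−1}(ε_1) is nondegenerate, and hence g_{−1}(ε_1) is semisimple, for every ε_1 ≠ 0. -/

import Mathlib

/-- The underlying space `ℝ⁸` of the family `g_α`. -/
abbrev V8 : Type := Fin 8 → ℝ

/-- The standard basis vector `X_{k+1}` (0-indexed: `e8 k`). -/
def e8 (k : Fin 8) : V8 := fun l => if l = k then 1 else 0

/-- Brackets of basis elements of `g_α` for `i < j` (0-indexed, `X_{i+1} = e8 i`):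
`u α i j = [X_{i+1}, X_{j+1}]`. -/
noncomputable def gUpper (α : ℝ) : Fin 8 → Fin 8 → V8 := fun i j =>
  match (i : ℕ), (j : ℕ) with
  | 0, 1 => (2 : ℝ) • e8 1          -- [X₁,X₂] = 2X₂
  | 0, 2 => (-2 : ℝ) • e8 2         -- [X₁,X₃] = −2X₃
  | 1, 2 => e8 0                    -- [X₂,X₃] = X₁
  | 0, 3 => e8 3                    -- [X₁,X₄] = X₄
  | 0, 4 => -e8 4                   -- [X₁,X₅] = −X₅
  | 0, 5 => e8 5                    -- [X₁,X₆] = X₆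
  | 0, 6 => -e8 6                   -- [X₁,X₇] = −X₇
  | 1, 4 => e8 3                    -- [X₂,X₅] = X₄
  | 1, 6 => e8 5                    -- [X₂,X₇] = X₆
  | 2, 3 => e8 4                    -- [X₃,X₄] = X₅
  | 2, 5 => e8 6                    -- [X₃,X₆] = X₇
  | 3, 7 => e8 3                    -- [X₄,X₈] = X₄
  | 4, 7 => e8 4                    -- [X₅,X₈] = X₅
  | 5, 7 => α • e8 5                -- [X₆,X₈] = αX₆
  | 6, 7 => α • e8 6                -- [X₇,X₈] = αX₇
  | _, _ => 0

/-- The structure constants `C_{ij}^k` of `g_α`. -/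
noncomputable def gC (α : ℝ) (i j k : Fin 8) : ℝ := gUpper α i j k - gUpper α j i k

/-- The bilinear map on `ℝ⁸` with structure constants `C`. -/
noncomputable def brOf (C : Fin 8 → Fin 8 → Fin 8 → ℝ) : V8 →ₗ[ℝ] V8 →ₗ[ℝ] V8 :=
  LinearMap.mk₂ ℝ (fun x y k => ∑ i, ∑ j, C i j k * x i * y j)
    (by
      intro x x' y
      funext k
      simp only [Pi.add_apply]
      rw [← Finset.sum_add_distrib]
      refine Finset.sum_congr rfl fun i _ => ?_
      rw [← Finset.sum_add_distrib]
      exact Finset.sum_congr rfl fun j _ => by ring)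
    (by
      intro c x y
      funext k
      simp only [Pi.smul_apply, smul_eq_mul]
      rw [Finset.mul_sum]
      refine Finset.sum_congr rfl fun i _ => ?_
      rw [Finset.mul_sum]
      exact Finset.sum_congr rfl fun j _ => by ring)
    (by
      intro x y y'
      funext k
      simp only [Pi.add_apply]
      rw [← Finset.sum_add_distrib]
      refine Finset.sum_congr rfl fun i _ => ?_
      rw [← Finset.sum_add_distrib]
      exact Finset.sum_congr rfl fun j _ => by ring)
    (by
      intro c x y
      funext k
      simp only [Pi.smul_apply, smul_eq_mul]
      rw [Finset.mul_sum]
      refine Finset.sum_congr rfl fun i _ => ?_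
      rw [Finset.mul_sum]
      exact Finset.sum_congr rfl fun j _ => by ring)

/-- The Lie bracket `μ_α` of the Lie algebra `g_α`, as a bilinear map on `ℝ⁸`. -/
noncomputable def brA (α : ℝ) : V8 →ₗ[ℝ] V8 →ₗ[ℝ] V8 := brOf (gC α)

/-- Values `φ₁(X_{i+1}, X_{j+1})` for `i < j` (0-indexed). -/
noncomputable def phi1Upper : Fin 8 → Fin 8 → V8 := fun i j =>
  match (i : ℕ), (j : ℕ) with
  | 3, 5 => e8 1                                        -- φ₁(X₄,X₆) = X₂
  | 3, 6 => (-(1:ℝ)/2) • e8 0 + ((3:ℝ)/2) • e8 7        -- φ₁(X₄,X₇) = −½X₁+³⁄₂X₈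
  | 4, 5 => (-(1:ℝ)/2) • e8 0 - ((3:ℝ)/2) • e8 7        -- φ₁(X₅,X₆) = −½X₁−³⁄₂X₈
  | 4, 6 => -e8 2                                       -- φ₁(X₅,X₇) = −X₃
  | _, _ => 0

/-- The alternating bilinear map `φ₁` on `ℝ⁸`. -/
noncomputable def phi1 : V8 →ₗ[ℝ] V8 →ₗ[ℝ] V8 :=
  brOf (fun i j k => phi1Upper i j k - phi1Upper j i k)

/-- Values `φ₂(X_{i+1}, X_{j+1})` for `i < j` (0-indexed). -/
noncomputable def phi2Upper : Fin 8 → Fin 8 → V8 := fun i j =>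
  match (i : ℕ), (j : ℕ) with
  | 5, 7 => e8 5                                        -- φ₂(X₆,X₈) = X₆
  | 6, 7 => e8 6                                        -- φ₂(X₇,X₈) = X₇
  | _, _ => 0

/-- The alternating bilinear map `φ₂` on `ℝ⁸`. -/
noncomputable def phi2 : V8 →ₗ[ℝ] V8 →ₗ[ℝ] V8 :=
  brOf (fun i j k => phi2Upper i j k - phi2Upper j i k)

/-- The bracket of the deformed Lie algebra `g_{−1}(ε₁) = (ℝ⁸, μ_{−1} + ε₁φ₁)`. -/
noncomputable def brD (ε₁ : ℝ) : V8 →ₗ[ℝ] V8 →ₗ[ℝ] V8 := brA (-1) + ε₁ • phi1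

/-- The Killing form `κ(x,y) = tr(ad x ∘ ad y)` of `g_{−1}(ε₁)`. -/
noncomputable def killing (ε₁ : ℝ) (x y : V8) : ℝ :=
  LinearMap.trace ℝ V8 ((brD ε₁ x) ∘ₗ (brD ε₁ y))

/-- The matrix of the Killing form of `g_{−1}(ε₁)` in the basis `X₁,…,X₈`. -/
noncomputable def killingMat (ε₁ : ℝ) : Matrix (Fin 8) (Fin 8) ℝ :=
  Matrix.of fun i j => killing ε₁ (e8 i) (e8 j)

theorem brOf_apply (C : Fin 8 → Fin 8 → Fin 8 → ℝ) (x y : V8) (k : Fin 8) :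
    brOf C x y k = ∑ i, ∑ j, C i j k * x i * y j := rfl

set_option maxHeartbeats 4000000 in
/-- The bracket of `g_{−1}(ε)` in coordinates. -/
theorem brD_apply (ε : ℝ) (x y : V8) :
    brD ε x y =
      ![(x 1 * y 2 - x 2 * y 1) - ε / 2 * (x 3 * y 6 - x 6 * y 3)
          - ε / 2 * (x 4 * y 5 - x 5 * y 4),
        2 * (x 0 * y 1 - x 1 * y 0) + ε * (x 3 * y 5 - x 5 * y 3),
        -2 * (x 0 * y 2 - x 2 * y 0) - ε * (x 4 * y 6 - x 6 * y 4),
        (x 0 * y 3 - x 3 * y 0) + (x 1 * y 4 - x 4 * y 1) + (x 3 * y 7 - x 7 * y 3),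
        -(x 0 * y 4 - x 4 * y 0) + (x 2 * y 3 - x 3 * y 2) + (x 4 * y 7 - x 7 * y 4),
        (x 0 * y 5 - x 5 * y 0) + (x 1 * y 6 - x 6 * y 1) - (x 5 * y 7 - x 7 * y 5),
        -(x 0 * y 6 - x 6 * y 0) + (x 2 * y 5 - x 5 * y 2) - (x 6 * y 7 - x 7 * y 6),
        3 * ε / 2 * (x 3 * y 6 - x 6 * y 3) - 3 * ε / 2 * (x 4 * y 5 - x 5 * y 4)] := by
  funext k
  have h : brD ε x y k = brOf (gC (-1)) x y k +
      ε * brOf (fun i j k => phi1Upper i j k - phi1Upper j i k) x y k := rfl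
  rw [h, brOf_apply, brOf_apply]
  fin_cases k <;>
  · simp [Fin.sum_univ_eight, gC, gUpper, phi1Upper, e8]
    ring

theorem brD_swap (ε : ℝ) (x y : V8) : brD ε x y = -brD ε y x := by
  rw [brD_apply, brD_apply]
  funext k
  fin_cases k <;> simp <;> ring

set_option maxHeartbeats 4000000 in
/-- The Killing form of `g_{−1}(ε)` in coordinates. -/
theorem killing_apply (ε : ℝ) (x y : V8) :
    killing ε x y = 12 * (x 0 * y 0) + 6 * (x 1 * y 2 + x 2 * y 1)
      - 6 * ε * (x 3 * y 6 + x 6 * y 3) + 6 * ε * (x 4 * y 5 + x 5 * y 4)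
      + 4 * (x 7 * y 7) := by
  rw [killing, LinearMap.trace_eq_matrix_trace ℝ (Pi.basisFun ℝ (Fin 8)), Matrix.trace]
  simp only [Matrix.diag_apply, LinearMap.toMatrix_apply, LinearMap.comp_apply,
    Pi.basisFun_apply, Pi.basisFun_repr, Fin.sum_univ_eight]
  simp [brD_apply]
  ring

theorem killingMat_eq (ε : ℝ) :
    killingMat ε = !![12, 0, 0, 0, 0, 0, 0, 0;
                      0, 0, 6, 0, 0, 0, 0, 0;
                      0, 6, 0, 0, 0, 0, 0, 0;
                      0, 0, 0, 0, 0, 0, -6 * ε, 0;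
                      0, 0, 0, 0, 0, 6 * ε, 0, 0;
                      0, 0, 0, 0, 6 * ε, 0, 0, 0;
                      0, 0, 0, -6 * ε, 0, 0, 0, 0;
                      0, 0, 0, 0, 0, 0, 0, 4] := by
  ext i j
  rw [killingMat, Matrix.of_apply, killing_apply]
  fin_cases i <;> fin_cases j <;> simp [e8]

set_option maxHeartbeats 4000000 in
theorem det_killingMat (ε : ℝ) : (killingMat ε).det = -(2 ^ 10 * 3 ^ 7) * ε ^ 4 := by
  rw [killingMat_eq]
  simp [Matrix.det_succ_row_zero, Fin.sum_univ_succ, Fin.succAbove]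
  ring

theorem eq_zero_of_killing_eq_zero {ε : ℝ} (hε : ε ≠ 0) {x : V8}
    (h : ∀ y : V8, killing ε x y = 0) : x = 0 := by
  funext k
  have h' : ∀ j, killing ε x (e8 j) = 0 := fun j => h (e8 j)
  simp only [killing_apply] at h'
  fin_cases k
  · simpa [e8] using h' 0
  · simpa [e8] using h' 2
  · simpa [e8] using h' 1
  · simpa [e8, hε] using h' 6
  · simpa [e8, hε] using h' 5
  · simpa [e8, hε] using h' 4
  · simpa [e8, hε] using h' 3
  · simpa [e8] using h' 7

/-- An abelian ideal is contained in the radical of the Killing form. -/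
theorem killing_eq_zero_of_mem_abelian_ideal {ε : ℝ} {I : Submodule ℝ V8}
    (hI : ∀ x ∈ I, ∀ y : V8, brD ε y x ∈ I) (hab : ∀ x ∈ I, ∀ y ∈ I, brD ε x y = 0)
    {x : V8} (hx : x ∈ I) (y : V8) : killing ε x y = 0 := by
  have hsq : IsNilpotent (brD ε x ∘ₗ brD ε y) := by
    refine ⟨2, LinearMap.ext fun z => ?_⟩
    rw [pow_two]
    refine hab x hx _ (hI _ ?_ y)
    change brD ε x (brD ε y z) ∈ I
    rw [brD_swap]
    exact I.neg_mem (hI x hx _)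
  exact (LinearMap.isNilpotent_trace_of_isNilpotent hsq).eq_zero

/-- The Killing matrix of `g_{−1}(ε₁)` has determinant `−2¹⁰·3⁷·ε₁⁴`; in particular for
`ε₁ ≠ 0` the Killing form is nondegenerate and hence `g_{−1}(ε₁)` is semisimple (it has
no nonzero abelian ideal). -/
theorem killing_det_and_semisimple (ε₁ : ℝ) :
    (killingMat ε₁).det = -(2 ^ 10 * 3 ^ 7) * ε₁ ^ 4 ∧
    (ε₁ ≠ 0 →
      (∀ x : V8, (∀ y : V8, killing ε₁ x y = 0) → x = 0) ∧
      (∀ I : Submodule ℝ V8, (∀ x ∈ I, ∀ y : V8, brD ε₁ y x ∈ I) →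
        (∀ x ∈ I, ∀ y ∈ I, brD ε₁ x y = 0) → I = ⊥)) := by
  refine ⟨det_killingMat ε₁, fun hε =>
    ⟨fun x h => eq_zero_of_killing_eq_zero hε h, fun I hI hab => ?_⟩⟩
  rw [Submodule.eq_bot_iff]
  exact fun x hx =>
    eq_zero_of_killing_eq_zero hε (killing_eq_zero_of_mem_abelian_ideal hI hab hx)
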